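/- Let w_1,…,w_n be positive integers and let F ∈ ℝ[z_1,…,z_n] be quasihomogeneous of weight w(F) with respect to these weights (every monomial z^α of F satisfies Σ_j w_j α_j = w(F)). Let P(τ,ξ) = τ^m + Σ_{i=1}^m P_{m-i}(ξ) τ^{m-i} be a real polynomial in which each P_{m-i}(ξ) ∈ ℝ[ξ_1,…,ξ_n] is homogeneous of degree i, and define the phase polynomial ψ(x,t,z) = P(⟨x−z, ∇F(z)⟩, t·∇F(z)) ∈ ℝ[x_1,…,x_n,t,z_1,…,z_n], where ⟨x−z, ∇F(z)⟩ = Σ_j (x_j − z_j)·∂F/∂z_j(z). Then there exist a natural number μ′, multi-indices α^{(1)},…,α^{(μ′)} ∈ ℕ^n each satisfying the weight bound Σ_j w_j α^{(i)}_j < m·w(F), and polynomials W_1(x,t),…,W_{μ′}(x,t) ∈ ℝ[x_1,…,x_n,t] each of total degree at most m, such that ψ(x,t,z) = (−1)^m ⟨z, ∇F(z)⟩^m + Σ_{i=1}^{μ′} W_i(x,t)·z^{α^{(i)}}, where ⟨z, ∇F(z)⟩ = Σ_j z_j·∂F/∂z_j(z). -/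

import Mathlib

open MvPolynomial

open scoped Pointwise in
theorem MvPolynomial.mul_mem_restrictSupport {σ R : Type*} [CommSemiring R] {s t r : Set (σ →₀ ℕ)}
    {p q : MvPolynomial σ R} (hp : p ∈ restrictSupport R s) (hq : q ∈ restrictSupport R t)
    (h : ∀ a ∈ s, ∀ b ∈ t, a + b ∈ r) : p * q ∈ restrictSupport R r :=
  restrictSupport_mono R (Set.add_subset_iff.2 h)
    (restrictSupport_add (R := R) s t ▸ Submodule.mul_mem_mul hp hq)

theorem MvPolynomial.IsHomogeneous.aeval_mem_pow {σ R A : Type*} [CommSemiring R] [CommSemiring A]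
    [Algebra R A] {p : MvPolynomial σ R} {i : ℕ} (hp : p.IsHomogeneous i) {f : σ → A}
    {N : Submodule R A} (hf : ∀ j, f j ∈ N) :
    MvPolynomial.aeval f p ∈ N ^ i := by
  rw [aeval_def, eval₂_eq]
  refine Submodule.sum_mem _ fun d hd => ?_
  rw [← Algebra.smul_def]
  refine Submodule.smul_mem _ _ ?_
  have hdeg : ∑ j ∈ d.support, d j = i := by
    rw [← Finsupp.degree_apply, Finsupp.degree_eq_weight_one]
    exact hp (mem_support_iff.1 hd)
  rw [← hdeg]
  induction d.support using Finset.cons_induction with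
  | empty => simpa using Submodule.one_le.1 (le_refl (1 : Submodule R A))
  | cons j t hj ih =>
    rw [Finset.prod_cons, Finset.sum_cons, pow_add]
    exact Submodule.mul_mem_mul (Submodule.pow_mem_pow _ (hf j) _) ih

/-- Polynomials all of whose monomials have `u`-weight at most `d` and `v`-weight less than `k`. -/
noncomputable def boundedWeight {σ : Type*} (u v : σ → ℕ) (d k : ℕ) :
    Submodule ℝ (MvPolynomial σ ℝ) :=
  restrictSupport ℝ {s | Finsupp.weight u s ≤ d ∧ Finsupp.weight v s < k}

namespace boundedWeight

variable {σ : Type*} {u v : σ → ℕ} {d d' k k' : ℕ} {p q : MvPolynomial σ ℝ}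

theorem mono (hd : d ≤ d') (hk : k ≤ k') : boundedWeight u v d k ≤ boundedWeight u v d' k' :=
  restrictSupport_mono ℝ fun _ hs => ⟨hs.1.trans hd, hs.2.trans_le hk⟩

theorem mul_mem (hp : p ∈ boundedWeight u v d (k + 1)) (hq : q ∈ boundedWeight u v d' k') :
    p * q ∈ boundedWeight u v (d + d') (k + k') := by
  refine mul_mem_restrictSupport hp hq ?_
  rintro a ⟨ha, ha'⟩ b ⟨hb, hb'⟩
  simp only [Set.mem_ofPred_eq, map_add]
  omega

theorem one_mem : (1 : MvPolynomial σ ℝ) ∈ boundedWeight u v 0 1 := by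
  rw [boundedWeight, ← C_1, ← monomial_zero', monomial_mem_restrictSupport]
  simp

theorem X_mem (j : σ) : (X j : MvPolynomial σ ℝ) ∈ boundedWeight u v (u j) (v j + 1) := by
  rw [boundedWeight, X, monomial_mem_restrictSupport]
  simp [Finsupp.weight_single]

theorem pow_mem (hp : p ∈ boundedWeight u v d (k + 1)) (j : ℕ) :
    p ^ j ∈ boundedWeight u v (j * d) (j * k + 1) := by
  induction j with
  | zero => simpa using one_mem
  | succ j ih =>
    rw [pow_succ, add_mul, add_mul, one_mul, one_mul, add_assoc]
    exact mul_mem ih hp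

theorem pow_succ_le (j : ℕ) :
    boundedWeight u v d k ^ (j + 1) ≤ boundedWeight u v ((j + 1) * d) ((j + 1) * k) := by
  induction j with
  | zero => simp
  | succ j ih =>
    rw [pow_succ, Submodule.mul_le]
    intro a ha b hb
    rw [add_mul (j + 1), add_mul (j + 1), one_mul, one_mul]
    exact mul_mem (mono le_rfl (Nat.le_succ _) (ih ha)) hb

theorem add_pow_sub_pow_mem (hp : p ∈ boundedWeight u v d k)
    (hq : q ∈ boundedWeight u v d (k + 1)) (j : ℕ) :
    (p + q) ^ j - q ^ j ∈ boundedWeight u v (j * d) (j * k) := by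
  induction j with
  | zero => simp
  | succ j ih =>
    have hpq := pow_mem (add_mem (mono le_rfl (Nat.le_succ k) hp) hq) j
    have h : (p + q) ^ (j + 1) - q ^ (j + 1)
        = (p + q) ^ j * p + q * ((p + q) ^ j - q ^ j) := by ring
    rw [h, add_mul, add_mul, one_mul, one_mul]
    refine add_mem (mul_mem hpq hp) ?_
    rw [add_comm (j * d), add_comm (j * k)]
    exact mul_mem hq ih

end boundedWeight

theorem weight_add_of_mem_support_pderiv {σ R : Type*} [CommSemiring R] {w : σ → ℕ} {N : ℕ}
    {F : MvPolynomial σ R} (hF : F.IsWeightedHomogeneous w N) {j : σ} {s : σ →₀ ℕ}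
    (hs : s ∈ (pderiv j F).support) : Finsupp.weight w s + w j = N := by
  rw [mem_support_iff, coeff_pderiv] at hs
  simpa [Finsupp.weight_single] using hF (left_ne_zero_of_mul hs)

theorem Finsupp.weight_mapDomain {σ τ : Type*} (f : σ → τ) (v : τ → ℕ) (s : σ →₀ ℕ) :
    Finsupp.weight v (s.mapDomain f) = Finsupp.weight (v ∘ f) s := by
  simp only [Finsupp.weight_apply]
  exact Finsupp.sum_mapDomain_index (by simp) (by simp [add_mul])

/-- A polynomial in the variables `x`, `t`, `z` splits as a finite sum of monomials `z^α` with
coefficients in `x`, `t`. -/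
theorem exists_eq_sum_rename_mul_prod {ι κ : Type*} [Fintype ι] [Fintype κ] {w : κ → ℕ} {d k : ℕ}
    {p : MvPolynomial (ι ⊕ (Unit ⊕ κ)) ℝ}
    (hp : p ∈ boundedWeight (Sum.elim 1 (Sum.elim 1 0)) (Sum.elim 0 (Sum.elim 0 w)) d k) :
    ∃ (N : ℕ) (α : Fin N → κ → ℕ) (W : Fin N → MvPolynomial (ι ⊕ Unit) ℝ),
      (∀ i, ∑ j, w j * α i j < k) ∧ (∀ i, (W i).totalDegree ≤ d) ∧
      p = ∑ i, rename (Sum.map id Sum.inl) (W i) * ∏ j, X (Sum.inr (Sum.inr j)) ^ α i j := by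
  let e := p.support.equivFin.symm
  refine ⟨p.support.card, fun i j => (e i).1 (Sum.inr (Sum.inr j)),
    fun i => monomial (Finsupp.equivFunOnFinite.symm fun a => (e i).1 (Sum.map id Sum.inl a))
      (coeff (e i).1 p), fun i => ?_, fun i => ?_, ?_⟩
  · have h := (hp (e i).2).2
    simpa [Finsupp.weight_eq_sum, Fintype.sum_sum_type, mul_comm] using h
  · refine (totalDegree_monomial_le _ _).trans ?_
    have h := (hp (e i).2).1
    simpa [Finsupp.weight_eq_sum, Finsupp.sum_fintype, Fintype.sum_sum_type] using h
  · conv_lhs => rw [p.as_sum, ← Finset.sum_coe_sort, ← e.sum_comp]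
    refine Finset.sum_congr rfl fun i _ => ?_
    simp [monomial_eq, Finsupp.prod_fintype, Fintype.prod_sum_type, mul_assoc]

/-- Lemma 1.2 of the paper. Variables of the ambient polynomial ring
`ℝ[x_1,…,x_n,t,z_1,…,z_n]` are indexed by `Fin n ⊕ (Unit ⊕ Fin n)`:
`Sum.inl j` is `x_j`, `Sum.inr (Sum.inl ())` is `t`, and `Sum.inr (Sum.inr j)` is `z_j`.
For `F` quasihomogeneous of weight `wF` w.r.t. positive weights `w` and a symbol
`P(τ,ξ) = τ^m + ∑_{i=1}^m P_{m-i}(ξ) τ^{m-i}` with `P_{m-i}` homogeneous of degree `i`,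
the phase `ψ(x,t,z) = P(⟨x-z,∇F(z)⟩, t·∇F(z))` decomposes as
`ψ = (-1)^m ⟨z,∇F(z)⟩^m + ∑ᵢ Wᵢ(x,t)·z^{α⁽ⁱ⁾}` with `deg Wᵢ ≤ m` and
`∑ⱼ wⱼ α⁽ⁱ⁾ⱼ < m·wF`. -/
theorem stmt0 (n m : ℕ) (hm : 0 < m) (w : Fin n → ℕ) (hw : ∀ j, 0 < w j)
    (wF : ℕ) (F : MvPolynomial (Fin n) ℝ)
    (hF : ∀ α ∈ F.support, ∑ j, w j * α j = wF)
    (Pc : ℕ → MvPolynomial (Fin n) ℝ)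
    (hPc : ∀ i ∈ Finset.Icc 1 m, (Pc i).IsHomogeneous i) :
    -- the `x`-variables
    let xv : Fin n → MvPolynomial (Fin n ⊕ (Unit ⊕ Fin n)) ℝ := fun j => X (Sum.inl j)
    -- the `t`-variable
    let tv : MvPolynomial (Fin n ⊕ (Unit ⊕ Fin n)) ℝ := X (Sum.inr (Sum.inl ()))
    -- the `z`-variables
    let zv : Fin n → MvPolynomial (Fin n ⊕ (Unit ⊕ Fin n)) ℝ := fun j => X (Sum.inr (Sum.inr j))
    -- the partial derivatives `∂F/∂z_j`, viewed as polynomials in the `z`-variables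
    let dF : Fin n → MvPolynomial (Fin n ⊕ (Unit ⊕ Fin n)) ℝ :=
      fun j => rename (fun k => Sum.inr (Sum.inr k)) (pderiv j F)
    -- `⟨x - z, ∇F(z)⟩`
    let A : MvPolynomial (Fin n ⊕ (Unit ⊕ Fin n)) ℝ := ∑ j, (xv j - zv j) * dF j
    -- the phase `ψ(x,t,z) = P(⟨x-z,∇F(z)⟩, t·∇F(z))`
    let ψ : MvPolynomial (Fin n ⊕ (Unit ⊕ Fin n)) ℝ :=
      A ^ m + ∑ i ∈ Finset.Icc 1 m, aeval (fun j => tv * dF j) (Pc i) * A ^ (m - i)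
    ∃ (μ' : ℕ) (α : Fin μ' → Fin n → ℕ) (W : Fin μ' → MvPolynomial (Fin n ⊕ Unit) ℝ),
      (∀ i, ∑ j, w j * α i j < m * wF) ∧
      (∀ i, (W i).totalDegree ≤ m) ∧
      ψ = (-1) ^ m * (∑ j, zv j * dF j) ^ m +
        ∑ i, rename (Sum.map id Sum.inl) (W i) * ∏ j, zv j ^ α i j := by
  intro xv tv zv dF A ψ
  let u : Fin n ⊕ (Unit ⊕ Fin n) → ℕ := Sum.elim 1 (Sum.elim 1 0)
  let v : Fin n ⊕ (Unit ⊕ Fin n) → ℕ := Sum.elim 0 (Sum.elim 0 w)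
  have hFw : F.IsWeightedHomogeneous w wF := fun α hα => by
    rw [← hF α (mem_support_iff.2 hα), Finsupp.weight_eq_sum]
    simp [mul_comm]
  have hdF' : ∀ j, ∀ s ∈ (dF j).support,
      Finsupp.weight u s = 0 ∧ Finsupp.weight v s + w j = wF := by
    intro j s hs
    classical
    rw [show dF j = rename (Sum.inr ∘ Sum.inr) (pderiv j F) from rfl,
      support_rename_of_injective (Sum.inr_injective.comp Sum.inr_injective),
      Finset.mem_image] at hs
    obtain ⟨s, hs, rfl⟩ := hs
    rw [Finsupp.weight_mapDomain, Finsupp.weight_mapDomain]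
    refine ⟨?_, weight_add_of_mem_support_pderiv hFw hs⟩
    rw [Finsupp.weight_eq_sum]
    simp [u]
  have hdF : ∀ j, dF j ∈ boundedWeight u v 0 wF := fun j s hs => by
    have := hdF' j s hs
    have := hw j
    exact ⟨by omega, by omega⟩
  have hxdF : ∀ j, xv j * dF j ∈ boundedWeight u v 1 wF := fun j => by
    simpa [u, v] using boundedWeight.mul_mem (k := 0) (boundedWeight.X_mem (u := u) (v := v) (Sum.inl j)) (hdF j)
  have htdF : ∀ j, tv * dF j ∈ boundedWeight u v 1 wF := fun j => by
    simpa [u, v] using boundedWeight.mul_mem (k := 0)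
      (boundedWeight.X_mem (u := u) (v := v) (Sum.inr (Sum.inl ()))) (hdF j)
  have hzdF : ∀ j, zv j * dF j ∈ boundedWeight u v 1 (wF + 1) := fun j => by
    refine mul_mem_restrictSupport (boundedWeight.X_mem (u := u) (v := v) (Sum.inr (Sum.inr j)))
      (s := {s | Finsupp.weight u s ≤ 0 ∧ Finsupp.weight v s < w j + 1})
      (fun s hs => hdF' j s hs) ?_
    rintro a ⟨ha, ha'⟩ b ⟨hb, hb'⟩
    simp only [Set.mem_ofPred_eq, map_add]
    omega
  have ha := Submodule.sum_mem (boundedWeight u v 1 wF) (t := Finset.univ) fun j _ => hxdF j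
  have hb := neg_mem <|
    Submodule.sum_mem (boundedWeight u v 1 (wF + 1)) (t := Finset.univ) fun j _ => hzdF j
  have hA : A = ∑ j, xv j * dF j + -∑ j, zv j * dF j := by
    rw [← sub_eq_add_neg, ← Finset.sum_sub_distrib]
    exact Finset.sum_congr rfl fun j _ => sub_mul _ _ _
  have hA_mem : A ∈ boundedWeight u v 1 (wF + 1) :=
    hA ▸ add_mem (boundedWeight.mono le_rfl (Nat.le_succ _) ha) hb
  have hlead : A ^ m - (-∑ j, zv j * dF j) ^ m ∈ boundedWeight u v m (m * wF) := by
    simpa only [hA, mul_one] using boundedWeight.add_pow_sub_pow_mem ha hb m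
  have hlower : ∀ i ∈ Finset.Icc 1 m,
      aeval (fun j => tv * dF j) (Pc i) * A ^ (m - i) ∈ boundedWeight u v m (m * wF) := by
    intro i hi
    have h := (hPc i hi).aeval_mem_pow htdF
    obtain ⟨hi, him⟩ := Finset.mem_Icc.1 hi
    obtain ⟨i, rfl⟩ := Nat.exists_eq_succ_of_ne_zero (Nat.one_le_iff_ne_zero.1 hi)
    have h := boundedWeight.mul_mem (boundedWeight.pow_mem hA_mem (m - (i + 1)))
      (boundedWeight.pow_succ_le i h)
    rw [← add_mul, ← add_mul, Nat.sub_add_cancel him, mul_one] at h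
    rwa [mul_comm (A ^ _)] at h
  obtain ⟨N, α, W, hα, hW, h⟩ :=
    exists_eq_sum_rename_mul_prod (add_mem hlead (Submodule.sum_mem _ hlower))
  refine ⟨N, α, W, hα, hW, ?_⟩
  rw [← h, ← mul_pow, neg_one_mul]
  ring
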